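/- arXiv:1404.5214 — 2 statements merged into one kernel-verified Lean document; each statement's English description precedes it below -/
import Mathlib

section
/- Let x⁰ ∈ ℝⁿ be such that for every matrix A ∈ ℝ^{n×n} and every permutation matrix P ∈ ℝ^{n×n} one has (P A Pᵀ) · x⁰ = P · (A · x⁰). Then x⁰ is a scalar multiple of the all-ones vector, i.e., there exists c ∈ ℝ with x⁰(i) = c for all i. -/
open Matrix MeasureTheory Real BigOperators

/-- The permutation matrix of `σ`: `(P v) (σ i) = v i`. -/
noncomputable def permMatrix {n : ℕ} (σ : Equiv.Perm (Fin n)) : Matrix (Fin n) (Fin n) ℝ :=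
  Matrix.of fun i j => if i = σ j then 1 else 0

theorem permMatrix_mulVec_apply {n : ℕ} (σ : Equiv.Perm (Fin n)) (v : Fin n → ℝ) (i : Fin n) :
    (permMatrix σ *ᵥ v) (σ i) = v i := by
  simp [permMatrix, mulVec, dotProduct]

theorem permMatrix_transpose_mulVec_apply {n : ℕ} (σ : Equiv.Perm (Fin n)) (v : Fin n → ℝ)
    (i : Fin n) : ((permMatrix σ)ᵀ *ᵥ v) i = v (σ i) := by
  simp [permMatrix, mulVec, dotProduct]

/-- Uniqueness part of Theorem 1: a starting vector whose one-step power iteration is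
permutation-equivariant for all matrices `A` and all permutation matrices `P` must be
a scalar multiple of the all-ones vector. -/
theorem perm_equivariant_start_is_constant {n : ℕ} (x0 : Fin n → ℝ)
    (h : ∀ (A : Matrix (Fin n) (Fin n) ℝ) (σ : Equiv.Perm (Fin n)),
      (permMatrix σ * A * (permMatrix σ)ᵀ) *ᵥ x0 = permMatrix σ *ᵥ (A *ᵥ x0)) :
    ∃ c : ℝ, ∀ i, x0 i = c := by
  have fixed (σ : Equiv.Perm (Fin n)) (i : Fin n) : x0 (σ i) = x0 i := by
    have key := congrFun (h 1 σ) (σ i)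
    rwa [Matrix.mul_one, ← mulVec_mulVec, one_mulVec, permMatrix_mulVec_apply,
      permMatrix_mulVec_apply, permMatrix_transpose_mulVec_apply] at key
  rcases isEmpty_or_nonempty (Fin n) with _ | ⟨⟨k⟩⟩
  · exact ⟨0, isEmptyElim⟩
  · exact ⟨x0 k, fun i => by simpa using fixed (Equiv.swap k i) k⟩
end

section
/- Let A ∈ ℝ^{n×n} and let P ∈ ℝ^{n×n} be a permutation matrix. Assume that ‖x_A⁽ᵗ⁾‖₁ ≠ 0 for all 0 ≤ t < k. Then the sample covariance matrices of the rows of the power summaries coincide: Σ^{PAPᵀ} = Σ^A. -/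
open Matrix MeasureTheory Real BigOperators

/-- ℓ1 norm of a vector. -/
noncomputable def l1norm {n : ℕ} (v : Fin n → ℝ) : ℝ := ∑ i, |v i|

/-- Power iteration started at the all-ones vector. -/
noncomputable def powerIter {n : ℕ} (A : Matrix (Fin n) (Fin n) ℝ) : ℕ → (Fin n → ℝ)
  | 0 => fun _ => 1
  | t + 1 => A.mulVec ((l1norm (powerIter A t))⁻¹ • powerIter A t)

/-- Power summary `S^A ∈ ℝ^{n×k}`, whose `t`-th column is `x_A^{(t+1)}`. -/
noncomputable def powSummary {n : ℕ} (k : ℕ) (A : Matrix (Fin n) (Fin n) ℝ) :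
    Matrix (Fin n) (Fin k) ℝ :=
  Matrix.of fun i t => powerIter A (t + 1) i

/-- Mean vector of the rows of the power summary. -/
noncomputable def meanVec {n : ℕ} (k : ℕ) (A : Matrix (Fin n) (Fin n) ℝ) : Fin k → ℝ :=
  (n : ℝ)⁻¹ • ∑ i, powSummary k A i

/-- Sample covariance matrix of the rows of the power summary. -/
noncomputable def covMat {n : ℕ} (k : ℕ) (A : Matrix (Fin n) (Fin n) ℝ) :
    Matrix (Fin k) (Fin k) ℝ :=
  (n : ℝ)⁻¹ • ∑ i, vecMulVec (powSummary k A i - meanVec k A) (powSummary k A i - meanVec k A)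

theorem permMatrix_mul_mul_transpose {n : ℕ} (A : Matrix (Fin n) (Fin n) ℝ)
    (σ : Equiv.Perm (Fin n)) :
    permMatrix σ * A * (permMatrix σ)ᵀ = A.submatrix σ.symm σ.symm := by
  ext i j
  simp [permMatrix, Matrix.mul_apply, ← Equiv.symm_apply_eq]

theorem l1norm_comp_perm {n : ℕ} (v : Fin n → ℝ) (σ : Equiv.Perm (Fin n)) :
    l1norm (v ∘ σ) = l1norm v :=
  Equiv.sum_comp σ fun i => |v i|

theorem powerIter_submatrix {n : ℕ} (A : Matrix (Fin n) (Fin n) ℝ) (σ : Equiv.Perm (Fin n))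
    (t : ℕ) : powerIter (A.submatrix σ σ) t = powerIter A t ∘ σ := by
  induction t with
  | zero => rfl
  | succ t ih =>
    simp only [powerIter, ih, l1norm_comp_perm, Matrix.submatrix_mulVec_equiv]
    congr 2
    ext i
    simp

theorem powSummary_submatrix {n : ℕ} (k : ℕ) (A : Matrix (Fin n) (Fin n) ℝ)
    (σ : Equiv.Perm (Fin n)) (i : Fin n) :
    powSummary k (A.submatrix σ σ) i = powSummary k A (σ i) := by
  ext t
  simp [powSummary, powerIter_submatrix]

theorem meanVec_submatrix {n : ℕ} (k : ℕ) (A : Matrix (Fin n) (Fin n) ℝ)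
    (σ : Equiv.Perm (Fin n)) : meanVec k (A.submatrix σ σ) = meanVec k A := by
  simp only [meanVec, powSummary_submatrix]
  rw [Equiv.sum_comp σ fun i => powSummary k A i]

theorem covMat_submatrix {n : ℕ} (k : ℕ) (A : Matrix (Fin n) (Fin n) ℝ)
    (σ : Equiv.Perm (Fin n)) : covMat k (A.submatrix σ σ) = covMat k A := by
  simp only [covMat, powSummary_submatrix, meanVec_submatrix]
  rw [Equiv.sum_comp σ fun i =>
    vecMulVec (powSummary k A i - meanVec k A) (powSummary k A i - meanVec k A)]

/-- Part of Theorem 2: the sample covariance matrix of the rows of the power summary is a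
graph invariant. -/
theorem covMat_perm_invariant {n k : ℕ} (A : Matrix (Fin n) (Fin n) ℝ)
    (σ : Equiv.Perm (Fin n))
    (hl1 : ∀ t < k, l1norm (powerIter A t) ≠ 0) :
    covMat k (permMatrix σ * A * (permMatrix σ)ᵀ) = covMat k A := by
  rw [permMatrix_mul_mul_transpose, covMat_submatrix]
end
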